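/- Axiomatisation of PT⁺ in LT: for every set Δ ∪ {φ} of PT⁺ formulas, PT⁺: Δ ⊨ φ if and only if PVA ∪ Δ ⊨ φ in LT, where PVA = {□(P_i i∨ ∼P_i) : i ∈ ℕ}. -/

import Mathlib

/-- LT formulas: term algebra over variables with external connectives
`⊥, ¬, ∨, ∧` and internal connectives `i⊥, i¬, i∨, i∧`. -/
inductive Fm where
  | var  : ℕ → Fm
  | ebot : Fm
  | enot : Fm → Fm
  | eor  : Fm → Fm → Fm
  | eand : Fm → Fm → Fm
  | ibot : Fm
  | inot : Fm → Fm
  | ior  : Fm → Fm → Fm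
  | iand : Fm → Fm → Fm

/-- `H : Fm → Set B` is a homomorphism into the powerset algebra `𝒫 B`. -/
structure IsHom {B : Type} [BooleanAlgebra B] (H : Fm → Set B) : Prop where
  ebot : H .ebot = ∅
  enot : ∀ φ, H (.enot φ) = (H φ)ᶜ
  eor  : ∀ φ ψ, H (.eor φ ψ) = H φ ∪ H ψ
  eand : ∀ φ ψ, H (.eand φ ψ) = H φ ∩ H ψ
  ibot : H .ibot = {(⊥ : B)}
  inot : ∀ φ, H (.inot φ) = (fun a => aᶜ) '' H φ
  ior  : ∀ φ ψ, H (.ior φ ψ) = Set.image2 (· ⊔ ·) (H φ) (H ψ)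
  iand : ∀ φ ψ, H (.iand φ ψ) = Set.image2 (· ⊓ ·) (H φ) (H ψ)

/-- Entailment in LT. -/
def Entails (Δ : Set Fm) (ψ : Fm) : Prop :=
  ∀ (B : Type) [BooleanAlgebra B] (H : Fm → Set B),
    IsHom H → (⋂ φ ∈ Δ, H φ) ⊆ H ψ

/-- Labels: classical propositional formulas. -/
inductive Lb where
  | var : ℕ → Lb
  | bot : Lb
  | not : Lb → Lb
  | or  : Lb → Lb → Lb
  | and : Lb → Lb → Lb

/-- `h : Lb → B` is a label homomorphism (Boolean evaluation). -/
structure IsLbHom {B : Type} [BooleanAlgebra B] (h : Lb → B) : Prop where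
  bot : h .bot = ⊥
  not : ∀ a, h (.not a) = (h a)ᶜ
  or  : ∀ a b, h (.or a b) = h a ⊔ h b
  and : ∀ a b, h (.and a b) = h a ⊓ h b

/-- Atomic labels occurring in a label. -/
def Lb.atoms : Lb → Set ℕ
  | var i => {i}
  | bot => ∅
  | not a => a.atoms
  | or a b => a.atoms ∪ b.atoms
  | and a b => a.atoms ∪ b.atoms

/-- Two-valued (classical) evaluation of labels, for the tautology side condition. -/
def Lb.evalBool (v : ℕ → Bool) : Lb → Bool
  | var i => v i
  | bot => false
  | not a => !(a.evalBool v)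
  | or a b => a.evalBool v || b.evalBool v
  | and a b => a.evalBool v && b.evalBool v

/-- The internal top `i⊤ = i¬ i⊥`. -/
def Fm.itop : Fm := .inot .ibot

/-- The labelled formula `a = b`, i.e. `(a∨¬b)∧(¬a∨b) : i⊤`. -/
def lbEq (a b : Lb) : Lb × Fm :=
  (Lb.and (Lb.or a (Lb.not b)) (Lb.or (Lb.not a) b), Fm.itop)

/-- The labelled natural deduction system for LT. -/
inductive Proves : Set (Lb × Fm) → Lb × Fm → Prop where
  | hyp {Γ c} : c ∈ Γ → Proves Γ c
  | eandI {Γ a φ ψ} : Proves Γ (a, φ) → Proves Γ (a, ψ) →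
      Proves Γ (a, Fm.eand φ ψ)
  | eandE1 {Γ a φ ψ} : Proves Γ (a, Fm.eand φ ψ) → Proves Γ (a, φ)
  | eandE2 {Γ a φ ψ} : Proves Γ (a, Fm.eand φ ψ) → Proves Γ (a, ψ)
  | eorI1 {Γ a φ ψ} : Proves Γ (a, φ) → Proves Γ (a, Fm.eor φ ψ)
  | eorI2 {Γ a φ ψ} : Proves Γ (a, ψ) → Proves Γ (a, Fm.eor φ ψ)
  | eorE {Γ a b φ ψ σ} : Proves Γ (a, Fm.eor φ ψ) →
      Proves (insert (a, φ) Γ) (b, σ) → Proves (insert (a, ψ) Γ) (b, σ) →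
      Proves Γ (b, σ)
  | enotI {Γ a b φ} : Proves (insert (a, φ) Γ) (b, Fm.ebot) →
      Proves Γ (a, Fm.enot φ)
  | enotE {Γ a φ} : Proves Γ (a, φ) → Proves Γ (a, Fm.enot φ) →
      Proves Γ (a, Fm.ebot)
  | raa {Γ a b φ} : Proves (insert (a, Fm.enot φ) Γ) (b, Fm.ebot) →
      Proves Γ (a, φ)
  | botE {Γ a b φ} : Proves Γ (a, Fm.ebot) → Proves Γ (b, φ)
  | iandI {Γ a b φ ψ} : Proves Γ (a, φ) → Proves Γ (b, ψ) →
      Proves Γ (Lb.and a b, Fm.iand φ ψ)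
  | iandE {Γ} {a b : Lb} {p q : ℕ} {φ ψ σ : Fm} :
      p ≠ q →
      (∀ r ∈ Γ, p ∉ (Prod.fst r).atoms ∧ q ∉ (Prod.fst r).atoms) →
      p ∉ a.atoms → q ∉ a.atoms → p ∉ b.atoms → q ∉ b.atoms →
      Proves Γ (a, Fm.iand φ ψ) →
      Proves (insert (Lb.var p, φ) (insert (Lb.var q, ψ)
        (insert (lbEq a (Lb.and (Lb.var p) (Lb.var q))) Γ))) (b, σ) →
      Proves Γ (b, σ)
  | iorI {Γ a b φ ψ} : Proves Γ (a, φ) → Proves Γ (b, ψ) →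
      Proves Γ (Lb.or a b, Fm.ior φ ψ)
  | iorE {Γ} {a b : Lb} {p q : ℕ} {φ ψ σ : Fm} :
      p ≠ q →
      (∀ r ∈ Γ, p ∉ (Prod.fst r).atoms ∧ q ∉ (Prod.fst r).atoms) →
      p ∉ a.atoms → q ∉ a.atoms → p ∉ b.atoms → q ∉ b.atoms →
      Proves Γ (a, Fm.ior φ ψ) →
      Proves (insert (Lb.var p, φ) (insert (Lb.var q, ψ)
        (insert (lbEq a (Lb.or (Lb.var p) (Lb.var q))) Γ))) (b, σ) →
      Proves Γ (b, σ)
  | inotI {Γ a φ} : Proves Γ (a, φ) → Proves Γ (Lb.not a, Fm.inot φ)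
  | inotE {Γ a φ} : Proves Γ (a, Fm.inot φ) → Proves Γ (Lb.not a, φ)
  | taut {Γ b} (L : List Lb) :
      (∀ a ∈ L, Proves Γ (a, Fm.itop)) →
      (∀ v : ℕ → Bool, (∀ a ∈ L, a.evalBool v = true) → b.evalBool v = true) →
      Proves Γ (b, Fm.itop)
  | sub {Γ a b φ} : Proves Γ (lbEq a b) → Proves Γ (b, φ) → Proves Γ (a, φ)

/-- Semantic entailment for labelled formulas. -/
def LEntails (Γ : Set (Lb × Fm)) (c : Lb × Fm) : Prop :=
  ∀ (B : Type) [BooleanAlgebra B] (h : Lb → B) (H : Fm → Set B),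
    IsLbHom h → IsHom H →
    (∀ r ∈ Γ, h r.1 ∈ H r.2) → h c.1 ∈ H c.2

/-- Consistency of a set of labelled formulas. -/
def Consistent (Γ : Set (Lb × Fm)) : Prop := ¬ Proves Γ (Lb.bot, Fm.ebot)

/-- Strict negation on subsets of a Boolean algebra. -/
def sNeg {B : Type} [BooleanAlgebra B] (A : Set B) : Set B :=
  {b | ∀ a ∈ A, b ⊓ a = ⊥}

/-- Strict negation as a defined LT connective:
`∼φ = ¬(((φ i∧ ¬⊥) ∧ ¬ i⊥) i∨ ¬⊥)`. -/
def Fm.snot (φ : Fm) : Fm :=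
  .enot (.ior (.eand (.iand φ (.enot .ebot)) (.enot .ibot)) (.enot .ebot))

/-- The possibility operator `◇φ := (φ i∧ ¬⊥) i∨ ¬⊥`. -/
def Fm.diam (φ : Fm) : Fm := .ior (.iand φ (.enot .ebot)) (.enot .ebot)

/-- The necessity operator `□φ := ¬◇¬φ`. -/
def Fm.box (φ : Fm) : Fm := .enot (Fm.diam (.enot φ))

/-- The evaluation homomorphism determined by a variable assignment. -/
def Fm.eval {B : Type} [BooleanAlgebra B] (v : ℕ → Set B) : Fm → Set B
  | .var i => v i
  | .ebot => ∅
  | .enot φ => (φ.eval v)ᶜ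
  | .eor φ ψ => φ.eval v ∪ ψ.eval v
  | .eand φ ψ => φ.eval v ∩ ψ.eval v
  | .ibot => {⊥}
  | .inot φ => (fun a => aᶜ) '' φ.eval v
  | .ior φ ψ => Set.image2 (· ⊔ ·) (φ.eval v) (ψ.eval v)
  | .iand φ ψ => Set.image2 (· ⊓ ·) (φ.eval v) (ψ.eval v)

/-- A homomorphism has principal variables if every variable is sent to a
(non-empty) principal ideal. -/
def PrincipalVars {B : Type} [BooleanAlgebra B] (H : Fm → Set B) : Prop :=
  ∀ i, ∃ b : B, H (.var i) = {a | a ≤ b}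

/-- PT⁺ formulas. -/
inductive PTFm where
  | var     : ℕ → PTFm
  | snotVar : ℕ → PTFm
  | ibot    : PTFm
  | nb      : PTFm
  | ior     : PTFm → PTFm → PTFm
  | eand    : PTFm → PTFm → PTFm
  | eor     : PTFm → PTFm → PTFm

/-- PT⁺ formulas as LT formulas. -/
def PTFm.toFm : PTFm → Fm
  | .var i => .var i
  | .snotVar i => Fm.snot (.var i)
  | .ibot => .ibot
  | .nb => .enot .ibot
  | .ior φ ψ => .ior φ.toFm ψ.toFm
  | .eand φ ψ => .eand φ.toFm ψ.toFm
  | .eor φ ψ => .eor φ.toFm ψ.toFm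

/-- Valuational team-semantic denotations of PT⁺ formulas. -/
def PTFm.den : PTFm → Set (Set (ℕ → Bool))
  | .var i => {X | ∀ s ∈ X, s i = true}
  | .snotVar i => {X | ∀ s ∈ X, s i = false}
  | .ibot => {∅}
  | .nb => {X | X ≠ ∅}
  | .ior φ ψ => Set.image2 (· ∪ ·) φ.den ψ.den
  | .eand φ ψ => φ.den ∩ ψ.den
  | .eor φ ψ => φ.den ∪ ψ.den

/-- PT⁺ entailment. -/
def PTEntails (Δ : Set PTFm) (φ : PTFm) : Prop :=
  (⋂ δ ∈ Δ, PTFm.den δ) ⊆ PTFm.den φ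

/-- The valuation homomorphism `H_V : Fm → 𝒫(𝒫(2^ℕ))`. -/
def HV : Fm → Set (Set (ℕ → Bool)) :=
  Fm.eval (fun i => {X : Set (ℕ → Bool) | ∀ s ∈ X, s i = true})

/-- The principal variable axioms. -/
def PVA : Set Fm :=
  Set.range (fun i => Fm.box (Fm.ior (Fm.var i) (Fm.snot (Fm.var i))))

/-- A substitution: an algebra endomorphism of the term algebra of formulas. -/
structure IsSubst (σ : Fm → Fm) : Prop where
  ebot : σ .ebot = .ebot
  enot : ∀ φ, σ (.enot φ) = .enot (σ φ)
  eor  : ∀ φ ψ, σ (.eor φ ψ) = .eor (σ φ) (σ ψ)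
  eand : ∀ φ ψ, σ (.eand φ ψ) = .eand (σ φ) (σ ψ)
  ibot : σ .ibot = .ibot
  inot : ∀ φ, σ (.inot φ) = .inot (σ φ)
  ior  : ∀ φ ψ, σ (.ior φ ψ) = .ior (σ φ) (σ ψ)
  iand : ∀ φ ψ, σ (.iand φ ψ) = .iand (σ φ) (σ ψ)

/-- A bundled homomorphism into the powerset of a Boolean algebra. -/
structure LTHom where
  carrier : Type
  inst : BooleanAlgebra carrier
  H : Fm → Set carrier
  isHom : @IsHom carrier inst H

/-- Local entailment of a single homomorphism. -/
def LTHom.localEntails (h : LTHom) (Δ : Set Fm) (φ : Fm) : Prop :=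
  (⋂ δ ∈ Δ, h.H δ) ⊆ h.H φ

/-- Entailment relative to a class of homomorphisms. -/
def ClassEntails (C : Set LTHom) (Δ : Set Fm) (φ : Fm) : Prop :=
  ∀ h ∈ C, h.localEntails Δ φ

/-- The class `C` of homomorphisms is definable by the set `Ax` of formulas. -/
def DefinableBy (C : Set LTHom) (Ax : Set Fm) : Prop :=
  ∀ h : LTHom, h ∈ C ↔ ∀ π ∈ Ax, h.H π = Set.univ

/-- Every Boolean algebra embeds into a powerset. -/
theorem exists_injective_boundedLatticeHom_set (B : Type) [BooleanAlgebra B] :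
    ∃ (P : Type) (r : BoundedLatticeHom B (Set P)), Function.Injective r := by
  refine ⟨{I : Order.Ideal B // I.IsPrime},
    { toFun := fun a => {I | a ∉ I.1}
      map_sup' := ?_, map_inf' := ?_, map_top' := ?_, map_bot' := ?_ }, ?_⟩
  · intro a b
    ext I
    simp only [Set.mem_ofPred_eq, Order.Ideal.sup_mem_iff, Set.sup_eq_union, Set.mem_union]
    tauto
  · intro a b
    ext ⟨I, hI⟩
    have h : a ⊓ b ∈ I ↔ a ∈ I ∨ b ∈ I :=
      ⟨hI.mem_or_mem, fun h => h.elim (I.lower inf_le_left) (I.lower inf_le_right)⟩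
    simp only [Set.mem_ofPred_eq, Set.inf_eq_inter, Set.mem_inter_iff, h]
    tauto
  · ext ⟨I, hI⟩
    simpa using hI.toIsProper.top_notMem
  · ext I
    simp
  · have key : ∀ a b : B, (∀ I : Order.Ideal B, I.IsPrime → a ∉ I → b ∉ I) → a ≤ b := by
      intro a b h
      by_contra hab
      have hdis : Disjoint (Order.PFilter.principal a : Set B) (Order.Ideal.principal b) := by
        rw [Set.disjoint_left]
        intro x hx hx'
        exact hab ((Order.PFilter.mem_principal.1 hx).trans (Order.Ideal.mem_principal.1 hx'))
      obtain ⟨J, hJ, hbJ, haJ⟩ := DistribLattice.prime_ideal_of_disjoint_filter_ideal hdis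
      refine h J hJ (fun haJ' => ?_) (hbJ (Order.Ideal.mem_principal.2 le_rfl))
      exact Set.disjoint_left.1 haJ (Order.PFilter.mem_principal.2 le_rfl) haJ'
    intro a b hab
    have h : ∀ I : Order.Ideal B, I.IsPrime → (a ∉ I ↔ b ∉ I) := fun I hI =>
      Set.ext_iff.1 hab ⟨I, hI⟩
    exact le_antisymm (key a b fun I hI => (h I hI).1) (key b a fun I hI => (h I hI).2)

theorem IsHom.snot {B : Type} [BooleanAlgebra B] {H : Fm → Set B} (hH : IsHom H) (φ : Fm) :
    H (Fm.snot φ) = sNeg (H φ) := by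
  ext b
  simp only [Fm.snot, hH.enot, hH.ior, hH.eand, hH.iand, hH.ebot, hH.ibot, sNeg,
    Set.compl_empty, Set.mem_compl_iff, Set.mem_image2, Set.mem_ofPred_eq, Set.mem_inter_iff,
    Set.mem_univ, true_and, Set.mem_singleton_iff, not_exists, not_and]
  constructor
  · intro h a ha
    by_contra hne
    exact h (b ⊓ a) ⟨⟨a, ha, b, inf_comm a b⟩, hne⟩ b (by simp)
  · rintro h _ ⟨⟨a, ha, c, rfl⟩, hne⟩ d rfl
    refine hne (le_bot_iff.1 ?_)
    rw [← h a ha]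
    exact le_inf le_sup_left inf_le_left

theorem IsHom.mem_box {B : Type} [BooleanAlgebra B] {H : Fm → Set B} (hH : IsHom H) (φ : Fm)
    (a : B) : a ∈ H (Fm.box φ) ↔ H φ = Set.univ := by
  simp only [Fm.box, Fm.diam, hH.enot, hH.ior, hH.iand, hH.ebot, Set.compl_empty,
    Set.mem_compl_iff, Set.mem_image2, Set.mem_univ, true_and, Set.eq_univ_iff_forall]
  constructor
  · intro h b
    by_contra hb
    exact h ⟨b ⊓ ⊥, ⟨b, hb, ⊥, rfl⟩, a, by simp⟩
  · rintro h ⟨_, ⟨b, hb, _⟩, _⟩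
    exact hb (h b)

/-- If every element splits into a part in `A` and a part disjoint from `A`, then `A` is a
principal ideal. -/
theorem exists_eq_setOf_le_of_image2_sup_sNeg {B : Type} [BooleanAlgebra B] {A : Set B}
    (h : Set.image2 (· ⊔ ·) A (sNeg A) = Set.univ) : ∃ p : B, A = {a | a ≤ p} := by
  rw [Set.eq_univ_iff_forall] at h
  obtain ⟨p, hp, n, hn, hpn : p ⊔ n = ⊤⟩ := h ⊤
  refine ⟨p, Set.ext fun a => ⟨fun ha => ?_, fun ha => ?_⟩⟩
  · have hd : Disjoint a n := disjoint_iff.2 (by rw [inf_comm]; exact hn a ha)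
    exact Disjoint.left_le_of_le_sup_right (hpn ▸ le_top) hd
  · obtain ⟨q, hq, m, hm, rfl : q ⊔ m = a⟩ := h a
    have hmp : m ⊓ p = ⊥ := hm p hp
    rw [inf_eq_left.2 (le_sup_right.trans ha)] at hmp
    rwa [hmp, sup_bot_eq]

theorem image2_sup_sNeg_setOf_le {B : Type} [BooleanAlgebra B] (p : B) :
    Set.image2 (· ⊔ ·) {a | a ≤ p} (sNeg {a | a ≤ p}) = Set.univ := by
  refine Set.eq_univ_iff_forall.2 fun a => ⟨a ⊓ p, inf_le_right, a \ p, fun c hc => ?_, ?_⟩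
  · exact (disjoint_sdiff_self_left.mono_right hc).eq_bot
  · exact sup_inf_sdiff a p

theorem IsHom.mem_snot_of_var_eq {B : Type} [BooleanAlgebra B] {H : Fm → Set B} (hH : IsHom H)
    {i : ℕ} {p : B} (hp : H (.var i) = {a | a ≤ p}) (a : B) :
    a ∈ H (Fm.snot (.var i)) ↔ a ≤ pᶜ := by
  rw [hH.snot, hp, le_compl_iff_disjoint_right, disjoint_iff]
  exact ⟨fun h => h p le_rfl, fun h c hc => ((disjoint_iff.2 h).mono_right hc).eq_bot⟩

theorem Fm.isHom_eval {B : Type} [BooleanAlgebra B] (v : ℕ → Set B) : IsHom (Fm.eval v) where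
  ebot := rfl
  enot _ := rfl
  eor _ _ := rfl
  eand _ _ := rfl
  ibot := rfl
  inot _ := rfl
  ior _ _ := rfl
  iand _ _ := rfl

theorem HV_toFm (φ : PTFm) : HV φ.toFm = φ.den := by
  have hH : IsHom HV := Fm.isHom_eval _
  induction φ with
  | var i => rfl
  | snotVar i =>
    have hp : HV (.var i) = {X | X ≤ {s : ℕ → Bool | s i = true}} := rfl
    ext X
    rw [PTFm.toFm, hH.mem_snot_of_var_eq hp]
    simp [PTFm.den, Set.subset_def]
  | ibot => rfl
  | nb => rfl
  | ior φ ψ ih₁ ih₂ => rw [PTFm.toFm, hH.ior, ih₁, ih₂]; rfl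
  | eand φ ψ ih₁ ih₂ => rw [PTFm.toFm, hH.eand, ih₁, ih₂]; rfl
  | eor φ ψ ih₁ ih₂ => rw [PTFm.toFm, hH.eor, ih₁, ih₂]; rfl

/-- The type of a point of a powerset representation `r`, relative to a sequence `p`. -/
noncomputable def pointType {B P : Type} [BooleanAlgebra B] (r : BoundedLatticeHom B (Set P))
    (p : ℕ → B) (x : P) (i : ℕ) : Bool :=
  open Classical in decide (x ∈ r (p i))

theorem pointType_eq_true {B P : Type} [BooleanAlgebra B] {r : BoundedLatticeHom B (Set P)}
    {p : ℕ → B} {x : P} {i : ℕ} : pointType r p x i = true ↔ x ∈ r (p i) := by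
  simp [pointType]

/-- A set of valuations that depends on finitely many coordinates is represented in `B`. -/
theorem exists_mem_iff_pointType_mem {B P : Type} [BooleanAlgebra B]
    (r : BoundedLatticeHom B (Set P)) (p : ℕ → B) (n : ℕ) (S : Set (ℕ → Bool))
    (hS : ∀ s t : ℕ → Bool, (∀ i < n, s i = t i) → s ∈ S → t ∈ S) :
    ∃ c : B, ∀ x, x ∈ r c ↔ pointType r p x ∈ S := by
  induction n generalizing S with
  | zero =>
    by_cases h : S.Nonempty
    · obtain ⟨s, hs⟩ := h
      exact ⟨⊤, fun x => by simpa using hS s _ (by simp) hs⟩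
    · rw [Set.not_nonempty_iff_eq_empty] at h
      exact ⟨⊥, fun x => by simp [h]⟩
  | succ n ih =>
    have hdep : ∀ b : Bool, ∃ c : B, ∀ x, x ∈ r c ↔
        pointType r p x ∈ {s | Function.update s n b ∈ S} := by
      intro b
      refine ih _ fun s t hst hs => hS _ _ (fun i hi => ?_) hs
      by_cases hin : i = n
      · simp [hin]
      · simpa [hin] using hst i (by omega)
    obtain ⟨c, hc⟩ := hdep true
    obtain ⟨d, hd⟩ := hdep false
    refine ⟨(p n ⊓ c) ⊔ ((p n)ᶜ ⊓ d), fun x => ?_⟩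
    have hself := Function.update_eq_self n (pointType r p x)
    simp only [map_sup, map_inf, map_compl', Set.sup_eq_union, Set.inf_eq_inter, Set.mem_union,
      Set.mem_inter_iff, Set.mem_compl_iff, hc, hd, Set.mem_ofPred_eq, ← pointType_eq_true]
    cases hx : pointType r p x n <;> rw [hx] at hself <;> simp [hself]

/-- A set of points and a set of valuations realise the same restrictions to the
coordinates below `n`. -/
def SameTraces {P : Type} (τ : P → ℕ → Bool) (n : ℕ) (A : Set P) (X : Set (ℕ → Bool)) : Prop :=
  (∀ x ∈ A, ∃ s ∈ X, ∀ i < n, τ x i = s i) ∧ ∀ s ∈ X, ∃ x ∈ A, ∀ i < n, τ x i = s i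

theorem SameTraces.split_left {P : Type} {τ : P → ℕ → Bool} {n : ℕ} {A A' : Set P}
    {X : Set (ℕ → Bool)} (h : SameTraces τ n A X) (hA : A' ⊆ A) :
    SameTraces τ n A' {s ∈ X | ∃ x ∈ A', ∀ i < n, τ x i = s i} := by
  refine ⟨fun x hx => ?_, fun s hs => hs.2⟩
  obtain ⟨s, hs, hxs⟩ := h.1 x (hA hx)
  exact ⟨s, ⟨hs, x, hx, hxs⟩, hxs⟩

theorem SameTraces.split_right {P : Type} {τ : P → ℕ → Bool} {n : ℕ} {A : Set P}
    {X X' : Set (ℕ → Bool)} (h : SameTraces τ n A X) (hX : X' ⊆ X) :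
    SameTraces τ n {x ∈ A | ∃ s ∈ X', ∀ i < n, τ x i = s i} X' := by
  refine ⟨fun x hx => hx.2, fun s hs => ?_⟩
  obtain ⟨x, hx, hxs⟩ := h.2 s (hX hs)
  exact ⟨x, ⟨hx, s, hs, hxs⟩, hxs⟩

theorem SameTraces.eq_empty_iff {P : Type} {τ : P → ℕ → Bool} {n : ℕ} {A : Set P}
    {X : Set (ℕ → Bool)} (h : SameTraces τ n A X) : A = ∅ ↔ X = ∅ := by
  constructor <;> rintro rfl <;> refine Set.eq_empty_iff_forall_notMem.2 fun y hy => ?_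
  · obtain ⟨x, hx, -⟩ := h.2 y hy
    exact hx
  · obtain ⟨s, hs, -⟩ := h.1 y hy
    exact hs

theorem SameTraces.forall_iff {P : Type} {τ : P → ℕ → Bool} {n : ℕ} {A : Set P}
    {X : Set (ℕ → Bool)} (h : SameTraces τ n A X) {i : ℕ} (hi : i < n) (b : Bool) :
    (∀ x ∈ A, τ x i = b) ↔ ∀ s ∈ X, s i = b := by
  constructor
  · intro hA s hs
    obtain ⟨x, hx, hxs⟩ := h.2 s hs
    rw [← hxs i hi, hA x hx]
  · intro hX x hx
    obtain ⟨s, hs, hxs⟩ := h.1 x hx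
    rw [hxs i hi, hX s hs]

/-- Membership in the denotation of a PT⁺ formula depends only on the traces on a long enough
initial segment of the variables. -/
theorem exists_mem_toFm_iff_mem_den {B P : Type} [BooleanAlgebra B] {H : Fm → Set B}
    (hH : IsHom H) {p : ℕ → B} (hp : ∀ i, H (.var i) = {a | a ≤ p i})
    {r : BoundedLatticeHom B (Set P)} (hr : Function.Injective r) (φ : PTFm) :
    ∃ N, ∀ n ≥ N, ∀ (a : B) (X : Set (ℕ → Bool)),
      SameTraces (pointType r p) n (r a) X → (a ∈ H φ.toFm ↔ X ∈ φ.den) := by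
  have hle : ∀ a b : B, a ≤ b ↔ r a ⊆ r b := fun a b => by
    rw [← inf_eq_left, ← hr.eq_iff, map_inf]
    exact Set.inter_eq_left
  have hbot : ∀ a : B, a = ⊥ ↔ r a = ∅ := fun a => by
    rw [← hr.eq_iff, map_bot]
    rfl
  induction φ with
  | var i =>
    refine ⟨i + 1, fun n hn a X h => ?_⟩
    rw [PTFm.toFm, hp, Set.mem_ofPred_eq, hle, PTFm.den, Set.mem_ofPred_eq,
      ← h.forall_iff (by omega) true]
    simp only [pointType_eq_true, Set.subset_def]
  | snotVar i =>
    refine ⟨i + 1, fun n hn a X h => ?_⟩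
    rw [PTFm.toFm, hH.mem_snot_of_var_eq (hp i), hle, PTFm.den, Set.mem_ofPred_eq,
      ← h.forall_iff (by omega) false]
    simp only [← Bool.not_eq_true, pointType_eq_true, Set.subset_def, map_compl',
      Set.mem_compl_iff]
  | ibot =>
    refine ⟨0, fun n hn a X h => ?_⟩
    rw [PTFm.toFm, hH.ibot, Set.mem_singleton_iff, hbot, h.eq_empty_iff]
    rfl
  | nb =>
    refine ⟨0, fun n hn a X h => ?_⟩
    rw [PTFm.toFm, hH.enot, hH.ibot, Set.mem_compl_iff, Set.mem_singleton_iff, hbot,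
      h.eq_empty_iff]
    rfl
  | eand φ ψ ih₁ ih₂ =>
    obtain ⟨N₁, h₁⟩ := ih₁
    obtain ⟨N₂, h₂⟩ := ih₂
    refine ⟨max N₁ N₂, fun n hn a X h => ?_⟩
    rw [PTFm.toFm, hH.eand, Set.mem_inter_iff, h₁ n (by omega) a X h, h₂ n (by omega) a X h]
    rfl
  | eor φ ψ ih₁ ih₂ =>
    obtain ⟨N₁, h₁⟩ := ih₁
    obtain ⟨N₂, h₂⟩ := ih₂
    refine ⟨max N₁ N₂, fun n hn a X h => ?_⟩
    rw [PTFm.toFm, hH.eor, Set.mem_union, h₁ n (by omega) a X h, h₂ n (by omega) a X h]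
    rfl
  | ior φ ψ ih₁ ih₂ =>
    obtain ⟨N₁, h₁⟩ := ih₁
    obtain ⟨N₂, h₂⟩ := ih₂
    refine ⟨max N₁ N₂, fun n hn a X h => ?_⟩
    rw [PTFm.toFm, hH.ior]
    constructor
    · rintro ⟨b, hb, c, hc, rfl⟩
      have hbc : r (b ⊔ c) = r b ∪ r c := map_sup r b c
      have hY := h.split_left (A' := r b) (hbc ▸ Set.subset_union_left)
      have hZ := h.split_left (A' := r c) (hbc ▸ Set.subset_union_right)
      refine ⟨_, (h₁ n (by omega) b _ hY).1 hb, _, (h₂ n (by omega) c _ hZ).1 hc, ?_⟩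
      ext s
      constructor
      · rintro (hs | hs) <;> exact hs.1
      · intro hs
        obtain ⟨x, hx, hxs⟩ := h.2 s hs
        rw [show r ((fun x1 x2 => x1 ⊔ x2) b c) = r b ∪ r c from hbc] at hx
        exact hx.imp (fun hx => ⟨hs, x, hx, hxs⟩) (fun hx => ⟨hs, x, hx, hxs⟩)
    · rintro ⟨Y, hY, Z, hZ, rfl⟩
      have hpart : ∀ W ⊆ Y ∪ Z, ∃ b : B,
          r b = {x ∈ r a | ∃ s ∈ W, ∀ i < n, pointType r p x i = s i} := by
        intro W hW
        obtain ⟨c, hc⟩ := exists_mem_iff_pointType_mem r p n {t | ∃ s ∈ W, ∀ i < n, t i = s i}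
          fun s t hst ⟨u, hu, hsu⟩ => ⟨u, hu, fun i hi => (hst i hi).symm.trans (hsu i hi)⟩
        refine ⟨a ⊓ c, ?_⟩
        ext x
        rw [map_inf]
        exact and_congr_right fun _ => hc x
      obtain ⟨b, hb⟩ := hpart Y Set.subset_union_left
      obtain ⟨c, hc⟩ := hpart Z Set.subset_union_right
      refine ⟨b, (h₁ n (by omega) b Y ?_).2 hY, c, (h₂ n (by omega) c Z ?_).2 hZ, hr ?_⟩
      · exact hb ▸ h.split_right Set.subset_union_left
      · exact hc ▸ h.split_right Set.subset_union_right
      · rw [map_sup, hb, hc]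
        ext x
        constructor
        · rintro (hx | hx) <;> exact hx.1
        · intro hx
          obtain ⟨s, hs, hxs⟩ := h.1 x hx
          exact hs.imp (fun hs => ⟨hx, s, hs, hxs⟩) (fun hs => ⟨hx, s, hs, hxs⟩)

/-- Axiomatisation of PT⁺ as a fragment of LT by the principal variable
axioms. -/
theorem PT_axiomatisation (Δ : Set PTFm) (φ : PTFm) :
    PTEntails Δ φ ↔ Entails (PVA ∪ (PTFm.toFm '' Δ)) φ.toFm := by
  constructor
  · intro h B _ H hH a ha
    rw [Set.mem_iInter₂] at ha
    have hprin : ∀ i, ∃ p : B, H (.var i) = {a | a ≤ p} := fun i => by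
      have hi := (hH.mem_box _ a).1 (ha _ (Or.inl ⟨i, rfl⟩))
      rw [hH.ior, hH.snot] at hi
      exact exists_eq_setOf_le_of_image2_sup_sNeg hi
    choose p hp using hprin
    obtain ⟨P, r, hr⟩ := exists_injective_boundedLatticeHom_set B
    have hiff : ∀ ψ : PTFm, a ∈ H ψ.toFm ↔ pointType r p '' r a ∈ ψ.den := fun ψ => by
      obtain ⟨N, hN⟩ := exists_mem_toFm_iff_mem_den hH hp hr ψ
      refine hN N le_rfl a _ ⟨fun x hx => ⟨_, ⟨x, hx, rfl⟩, fun _ _ => rfl⟩, ?_⟩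
      rintro _ ⟨x, hx, rfl⟩
      exact ⟨x, hx, fun _ _ => rfl⟩
    refine (hiff φ).2 (h (Set.mem_iInter₂.2 fun δ hδ => (hiff δ).1 ?_))
    exact ha _ (Or.inr ⟨δ, hδ, rfl⟩)
  · intro h X hX
    have hH : IsHom HV := Fm.isHom_eval _
    rw [← HV_toFm]
    refine h (Set (ℕ → Bool)) HV hH (Set.mem_iInter₂.2 ?_)
    rintro _ (⟨i, rfl⟩ | ⟨δ, hδ, rfl⟩)
    · rw [hH.mem_box, hH.ior, hH.snot]
      exact image2_sup_sNeg_setOf_le {s : ℕ → Bool | s i = true}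
    · rw [HV_toFm]
      exact Set.mem_iInter₂.1 hX δ hδ
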